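/- Let G = (V₁,E₁) be a connected graph with |V₁| ≥ 2 and H = (V₂,E₂) an arbitrary graph with |V₂| ≥ 1. Then QEC(G⊙H) = 0 holds if either (i) QEC(G) = 0 and QEC(K₁+H) ≤ 0, or (ii) QEC(G) ≤ 0 and QEC(K₁+H) = 0. -/

import Mathlib

open scoped BigOperators
open Filter Topology
open scoped Classical

namespace QECPaper

/-- The cone (join) `K₁ + H` over a graph `H`: vertex `none` is the apex. -/
def cone {V₂ : Type*} (H : SimpleGraph V₂) : SimpleGraph (Option V₂) where
  Adj x y := (∃ a b, x = some a ∧ y = some b ∧ H.Adj a b) ∨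
    (x = none ∧ y ≠ none) ∨ (x ≠ none ∧ y = none)
  symm := by
    constructor
    rintro x y (⟨a, b, rfl, rfl, h⟩ | ⟨rfl, hy⟩ | ⟨hx, rfl⟩)
    · exact Or.inl ⟨b, a, rfl, rfl, h.symm⟩
    · exact Or.inr (Or.inr ⟨hy, rfl⟩)
    · exact Or.inr (Or.inl ⟨rfl, hx⟩)
  loopless := by
    constructor
    rintro x (⟨a, b, rfl, hb, h⟩ | ⟨rfl, hy⟩ | ⟨hx, rfl⟩)
    · exact H.loopless.irrefl a (by cases hb; exact h)
    · exact hy rfl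
    · exact hx rfl

/-- The corona `G ⊙ H` of two graphs, realized on `V₁ × ({o} ∪ V₂)`
with `o = none`. -/
def corona {V₁ V₂ : Type*} (G : SimpleGraph V₁) (H : SimpleGraph V₂) :
    SimpleGraph (V₁ × Option V₂) where
  Adj p q := (p.1 = q.1 ∧ (cone H).Adj p.2 q.2) ∨
    (G.Adj p.1 q.1 ∧ p.2 = none ∧ q.2 = none)
  symm := by
    constructor
    rintro ⟨i, x⟩ ⟨j, y⟩ (⟨h1, h2⟩ | ⟨h1, h2, h3⟩)
    · exact Or.inl ⟨h1.symm, (cone H).symm.symm _ _ h2⟩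
    · exact Or.inr ⟨h1.symm, h3, h2⟩
  loopless := by
    constructor
    rintro ⟨i, x⟩ (⟨h1, h2⟩ | ⟨h1, h2, h3⟩)
    · exact (cone H).loopless.irrefl x h2
    · exact G.loopless.irrefl i h1

/-- The quadratic embedding constant of a (connected) graph on a finite vertex set. -/
noncomputable def QEC {V : Type*} [Fintype V] (G : SimpleGraph V) : ℝ :=
  sSup {r : ℝ | ∃ f : V → ℝ, (∑ x, f x ^ 2) = 1 ∧ (∑ x, f x) = 0 ∧
    r = ∑ x, ∑ y, f x * (G.dist x y : ℝ) * f y}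

/-- The set `λ(S)` of `λ` appearing in a solution of the basic equations. -/
def lambdaS {V : Type*} [Fintype V] (G : SimpleGraph V) : Set ℝ :=
  {lam : ℝ | ∃ (f : V → ℝ) (μ : ℝ),
    (∀ x, (∑ y, (G.dist x y : ℝ) * f y) - lam * f x = μ / 2) ∧
    (∑ x, f x) = 0 ∧ (∑ x, f x ^ 2) = 1}

/-- The distance matrix of a graph, with real entries. -/
noncomputable def distMatrix {V : Type*} (G : SimpleGraph V) : Matrix V V ℝ :=
  Matrix.of fun x y => (G.dist x y : ℝ)

section MatrixFunctions

variable {ι : Type*} [Fintype ι] [DecidableEq ι]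

/-- The eigenspace `ker (A - α)` inside `EuclideanSpace ℝ ι`. -/
noncomputable def eigSpace (A : Matrix ι ι ℝ) (α : ℝ) :
    Submodule ℝ (EuclideanSpace ℝ ι) :=
  LinearMap.ker (Matrix.toEuclideanLin A - α • LinearMap.id)

/-- The all-ones vector of `EuclideanSpace ℝ ι`. -/
noncomputable def onesE (ι : Type*) [Fintype ι] : EuclideanSpace ℝ ι :=
  (WithLp.equiv 2 (ι → ℝ)).symm (fun _ => 1)

/-- `‖E_α 𝟏‖²`, where `E_α` is the orthogonal projection of `EuclideanSpace ℝ ι`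
onto the eigenspace `ker (A - α)`. -/
noncomputable def projNormSq (A : Matrix ι ι ℝ) (α : ℝ) : ℝ :=
  ‖(Submodule.orthogonalProjectionOnto (eigSpace A α) (onesE ι) : EuclideanSpace ℝ ι)‖ ^ 2

/-- The set of (real) eigenvalues of a matrix. -/
def evSet (A : Matrix ι ι ℝ) : Set ℝ :=
  {α : ℝ | ∃ v : ι → ℝ, v ≠ 0 ∧ A.mulVec v = α • v}

/-- The set of main eigenvalues: those `α` with `E_α 𝟏 ≠ 0`. -/
def mainEv (A : Matrix ι ι ℝ) : Set ℝ := {α : ℝ | projNormSq A α ≠ 0}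

/-- `k_A = |ev_M(A) \ {-2}|`. -/
noncomputable def kA (A : Matrix ι ι ℝ) : ℕ := (mainEv A \ {(-2 : ℝ)}).ncard

/-- The ω-function associated with the symmetric matrix `A`. -/
noncomputable def omegaFun (A : Matrix ι ι ℝ) (lam : ℝ) : ℝ :=
  1 + projNormSq A (-2) +
    ∑ᶠ α ∈ mainEv A \ {(-2 : ℝ)}, lam / (α + 2 + lam) * projNormSq A α

/-- The (maximal) domain of the ω-function: the complement of its poles. -/
def omegaDomain (A : Matrix ι ι ℝ) : Set ℝ :=
  {lam : ℝ | ∀ α ∈ mainEv A \ {(-2 : ℝ)}, lam ≠ -α - 2}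

/-- The set of zeroes of the ω-function (on its domain). -/
def omegaZeros (A : Matrix ι ι ℝ) : Set ℝ :=
  {lam : ℝ | lam ∈ omegaDomain A ∧ omegaFun A lam = 0}

/-- `λ*`, the largest zero of the ω-function. -/
noncomputable def lamStar (A : Matrix ι ι ℝ) : ℝ := sSup (omegaZeros A)

/-- The ψ-function associated with `A`: `ψ_A(λ) = λ/ω_A(λ)` extended
analytically across the poles of `ω_A` by the value `0`. -/
noncomputable def psiFun (A : Matrix ι ι ℝ) (lam : ℝ) : ℝ :=
  if -lam - 2 ∈ mainEv A \ {(-2 : ℝ)} then 0 else lam / omegaFun A lam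

/-- The inverse of the rightmost branch `ψ_{A*} = ψ_A ↾ (λ*, +∞)`:
`ψ_{A*}⁻¹(y)` is the unique `λ > λ*` with `ψ_A(λ) = y`. -/
noncomputable def psiStarInv (A : Matrix ι ι ℝ) (y : ℝ) : ℝ :=
  sSup {lam : ℝ | lamStar A < lam ∧ psiFun A lam = y}

end MatrixFunctions


/-- The quadratic form `⟨f, D f⟩` of the distance matrix `D` of `G`. -/
noncomputable def distForm {V : Type*} [Fintype V] (G : SimpleGraph V) (f : V → ℝ) : ℝ :=
  ∑ x, ∑ y, f x * (G.dist x y : ℝ) * f y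

lemma bddAbove_distForm {V : Type*} [Fintype V] (G : SimpleGraph V) :
    BddAbove {r : ℝ | ∃ f : V → ℝ, (∑ x, f x ^ 2) = 1 ∧ (∑ x, f x) = 0 ∧
      r = ∑ x, ∑ y, f x * (G.dist x y : ℝ) * f y} := by
  refine ⟨∑ x, ∑ y, (G.dist x y : ℝ), ?_⟩
  rintro r ⟨f, hf, -, rfl⟩
  have habs : ∀ x, |f x| ≤ 1 := fun x => by
    rw [← sq_le_one_iff_abs_le_one, ← hf]
    exact Finset.single_le_sum (f := fun x => f x ^ 2) (fun i _ => sq_nonneg _)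
      (Finset.mem_univ x)
  refine Finset.sum_le_sum fun x _ => Finset.sum_le_sum fun y _ => ?_
  have hxy : f x * f y ≤ 1 := by
    refine (le_abs_self _).trans ?_
    rw [abs_mul]
    exact mul_le_one₀ (habs x) (abs_nonneg _) (habs y)
  nlinarith [Nat.cast_nonneg (α := ℝ) (G.dist x y)]

lemma distForm_le_QEC {V : Type*} [Fintype V] (G : SimpleGraph V) {f : V → ℝ}
    (hf : ∑ x, f x ^ 2 = 1) (hf0 : ∑ x, f x = 0) : distForm G f ≤ QEC G :=
  le_csSup (bddAbove_distForm G) ⟨f, hf, hf0, rfl⟩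

lemma distForm_smul {V : Type*} [Fintype V] (G : SimpleGraph V) (a : ℝ) (f : V → ℝ) :
    distForm G (fun x => a * f x) = a ^ 2 * distForm G f := by
  simp only [distForm, Finset.mul_sum]
  exact Finset.sum_congr rfl fun x _ => Finset.sum_congr rfl fun y _ => by ring

lemma distForm_zero {V : Type*} [Fintype V] (G : SimpleGraph V) :
    distForm G (fun _ => 0) = 0 := by
  simp [distForm]

lemma distForm_nonpos {V : Type*} [Fintype V] {G : SimpleGraph V} (hG : QEC G ≤ 0)
    {f : V → ℝ} (hf0 : ∑ x, f x = 0) : distForm G f ≤ 0 := by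
  have hnn : 0 ≤ ∑ x, f x ^ 2 := Finset.sum_nonneg fun _ _ => sq_nonneg _
  rcases hnn.eq_or_lt with hs | hs
  · have hz : f = fun _ => 0 := by
      funext x
      have := (Finset.sum_eq_zero_iff_of_nonneg (fun i _ => sq_nonneg (f i))).1 hs.symm x
        (Finset.mem_univ x)
      simpa using this
    rw [hz, distForm_zero]
  · set a := (√(∑ x, f x ^ 2))⁻¹ with ha
    have ha2 : a ^ 2 * ∑ x, f x ^ 2 = 1 := by
      rw [ha, inv_pow, Real.sq_sqrt hnn, inv_mul_cancel₀ hs.ne']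
    have h1 : ∑ x, (a * f x) ^ 2 = 1 := by
      simp only [mul_pow, ← Finset.mul_sum, ha2]
    have h0 : ∑ x, a * f x = 0 := by rw [← Finset.mul_sum, hf0, mul_zero]
    have hle := (distForm_le_QEC G h1 h0).trans hG
    rw [distForm_smul] at hle
    have hapos : 0 < a ^ 2 := by
      rcases (sq_nonneg a).eq_or_lt with h | h
      · rw [← h, zero_mul] at ha2
        exact absurd ha2 zero_ne_one
      · exact h
    exact nonpos_of_mul_nonpos_right hle hapos

lemma exists_unit_sum_zero {V : Type*} [Fintype V] (hV : 2 ≤ Fintype.card V) :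
    ∃ f : V → ℝ, ∑ x, f x ^ 2 = 1 ∧ ∑ x, f x = 0 := by
  obtain ⟨u, v, huv⟩ := Fintype.one_lt_card_iff.1 hV
  refine ⟨fun x => (if x = u then (√2)⁻¹ else 0) - (if x = v then (√2)⁻¹ else 0), ?_, ?_⟩
  · have : ∀ x, ((if x = u then (√2)⁻¹ else 0) - (if x = v then (√2)⁻¹ else 0) : ℝ) ^ 2
        = (if x = u then 2⁻¹ else 0) + (if x = v then 2⁻¹ else 0) := fun x => by
      by_cases hu : x = u <;> by_cases hv : x = v
      · exact absurd (hu.symm.trans hv) huv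
      all_goals simp [hu, hv, huv, huv.symm]
    simp only [this, Finset.sum_add_distrib, Finset.sum_ite_eq', Finset.mem_univ, if_true]
    norm_num
  · simp

/-- If the unit sphere of the sum-zero functions on `V` maps to that on `W` compatibly with the
distance forms, then the quadratic embedding constants compare. -/
lemma QEC_le_of_map {V W : Type*} [Fintype V] [Fintype W] {G : SimpleGraph V}
    {K : SimpleGraph W} (hV : 2 ≤ Fintype.card V) (F : (V → ℝ) → W → ℝ)
    (hsq : ∀ f, ∑ w, F f w ^ 2 = ∑ x, f x ^ 2)
    (hsum : ∀ f, ∑ x, f x = 0 → ∑ w, F f w = 0)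
    (hform : ∀ f, ∑ x, f x = 0 → distForm K (F f) = distForm G f) : QEC G ≤ QEC K := by
  obtain ⟨f₀, h1, h0⟩ := exists_unit_sum_zero hV
  refine csSup_le ⟨_, f₀, h1, h0, rfl⟩ ?_
  rintro r ⟨f, hf, hf0, rfl⟩
  change distForm G f ≤ _
  rw [← hform f hf0]
  exact distForm_le_QEC K (by rw [hsq, hf]) (hsum f hf0)

lemma cone_connected {V₂ : Type*} (H : SimpleGraph V₂) : (cone H).Connected := by
  have key : ∀ x, (cone H).Reachable none x := by
    rintro (_ | x)
    · rfl
    · exact SimpleGraph.Adj.reachable (Or.inr (Or.inl ⟨rfl, by simp⟩))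
  have : Nonempty (Option V₂) := ⟨none⟩
  exact ⟨fun x y => (key x).symm.trans (key y)⟩

/-- The inclusion of the `i`-th copy of `K₁ + H` into the corona. -/
def coneHom {V₁ V₂ : Type*} (G : SimpleGraph V₁) (H : SimpleGraph V₂) (i : V₁) :
    cone H →g corona G H where
  toFun x := (i, x)
  map_rel' h := Or.inl ⟨rfl, h⟩

/-- The inclusion of `G` into the corona. -/
def baseHom {V₁ V₂ : Type*} (G : SimpleGraph V₁) (H : SimpleGraph V₂) :
    G →g corona G H where
  toFun i := (i, none)
  map_rel' h := Or.inr ⟨h, rfl, rfl⟩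

lemma dist_map_le {V W : Type*} {G : SimpleGraph V} {K : SimpleGraph W} (hG : G.Connected)
    (φ : G →g K) (x y : V) : K.dist (φ x) (φ y) ≤ G.dist x y := by
  obtain ⟨p, hp⟩ := hG.exists_walk_length_eq_dist x y
  rw [← hp, ← SimpleGraph.Walk.length_map φ p]
  exact SimpleGraph.dist_le _

lemma corona_connected {V₁ V₂ : Type*} {G : SimpleGraph V₁} (H : SimpleGraph V₂)
    (hG : G.Connected) : (corona G H).Connected := by
  have := hG.nonempty
  refine ⟨?_⟩
  rintro ⟨i, x⟩ ⟨j, y⟩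
  exact (((cone_connected H).preconnected x none).map (coneHom G H i)).trans
    (((hG.preconnected i j).map (baseHom G H)).trans
      (((cone_connected H).preconnected none y).map (coneHom G H j)))

lemma corona_le_length {V₁ V₂ : Type*} {G : SimpleGraph V₁} {H : SimpleGraph V₂}
    (hG : G.Connected) {p q : V₁ × Option V₂} (w : (corona G H).Walk p q) :
    (if p.1 = q.1 then (cone H).dist p.2 q.2
      else G.dist p.1 q.1 + (cone H).dist p.2 none + (cone H).dist none q.2) ≤ w.length := by
  induction w with
  | nil => simp
  | @cons p r q h w ih =>
    refine le_trans ?_ (Nat.add_le_add_right ih 1)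
    obtain ⟨i, x⟩ := p
    obtain ⟨k, z⟩ := r
    obtain ⟨j, y⟩ := q
    rcases h with ⟨h1, h2⟩ | ⟨h1, h2, h3⟩
    · dsimp only at h1 h2 ⊢
      subst h1
      have hd := SimpleGraph.dist_eq_one_iff_adj.2 h2
      have hy := (cone_connected H).dist_triangle (u := x) (v := z) (w := y)
      have ho := (cone_connected H).dist_triangle (u := x) (v := z) (w := none)
      split_ifs <;> omega
    · dsimp only at h1 h2 h3 ⊢
      subst h2 h3
      have hd := SimpleGraph.dist_eq_one_iff_adj.2 h1
      have ht := hG.dist_triangle (u := i) (v := k) (w := j)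
      have h0 : (cone H).dist none none = 0 := SimpleGraph.dist_self
      split_ifs with h4 h5 h5
      · omega
      · omega
      · subst h5
        omega
      · omega

lemma corona_dist {V₁ V₂ : Type*} {G : SimpleGraph V₁} (H : SimpleGraph V₂)
    (hG : G.Connected) (i j : V₁) (x y : Option V₂) :
    (corona G H).dist (i, x) (j, y) = if i = j then (cone H).dist x y
      else G.dist i j + (cone H).dist x none + (cone H).dist none y := by
  have hK := corona_connected H hG
  apply le_antisymm
  · have hx := dist_map_le (cone_connected H) (coneHom G H i)
    have hy := dist_map_le (cone_connected H) (coneHom G H j) none y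
    split_ifs with h
    · subst h
      exact hx x y
    · have hb := dist_map_le hG (baseHom G H) i j
      have h1 := hK.dist_triangle (u := (i, x)) (v := (i, none)) (w := (j, y))
      have h2 := hK.dist_triangle (u := (i, none)) (v := (j, none)) (w := (j, y))
      have hx' := hx x none
      change (corona G H).dist (i, x) (i, none) ≤ _ at hx'
      change (corona G H).dist (j, none) (j, y) ≤ _ at hy
      change (corona G H).dist (i, none) (j, none) ≤ _ at hb
      omega
  · obtain ⟨w, hw⟩ := hK.exists_walk_length_eq_dist (i, x) (j, y)
    rw [← hw]
    exact corona_le_length hG w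

/-- The function `f - ⟨1, f⟩ δ_o` on `{o} ∪ V₂`, which has sum zero. -/
noncomputable def recenter {V₂ : Type*} [Fintype V₂] (f : Option V₂ → ℝ) : Option V₂ → ℝ
  | none => -∑ x, f (some x)
  | some x => f (some x)

lemma sum_recenter {V₂ : Type*} [Fintype V₂] (f : Option V₂ → ℝ) :
    ∑ x, recenter f x = 0 := by
  simp [Fintype.sum_option, recenter]

lemma recenter_eq_self {V₂ : Type*} [Fintype V₂] {f : Option V₂ → ℝ} (hf : ∑ x, f x = 0) :
    recenter f = f := by
  funext x
  rw [Fintype.sum_option] at hf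
  cases x
  · simp only [recenter]
    linarith
  · rfl

lemma distForm_option {V₂ : Type*} [Fintype V₂] (K : SimpleGraph (Option V₂))
    (f : Option V₂ → ℝ) :
    distForm K f = 2 * f none * ∑ x, (K.dist (some x) none : ℝ) * f (some x) +
      ∑ x, ∑ y, f (some x) * (K.dist (some x) (some y) : ℝ) * f (some y) := by
  have h : ∀ x, K.dist none (some x) = K.dist (some x) none := fun x => SimpleGraph.dist_comm
  simp only [distForm, Fintype.sum_option, SimpleGraph.dist_self, h, Finset.sum_add_distrib,
    Finset.mul_sum]
  rw [← add_assoc]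
  congr 1
  simp only [Nat.cast_zero, mul_zero, zero_mul, zero_add, ← Finset.sum_add_distrib]
  exact Finset.sum_congr rfl fun x _ => by ring

lemma distForm_recenter {V₂ : Type*} [Fintype V₂] (K : SimpleGraph (Option V₂))
    (f : Option V₂ → ℝ) :
    distForm K (recenter f) = distForm K f -
      2 * (∑ x, f x) * ∑ x, (K.dist x none : ℝ) * f x := by
  rw [distForm_option, distForm_option, Fintype.sum_option, Fintype.sum_option]
  simp only [recenter, SimpleGraph.dist_self, Nat.cast_zero]
  ring

/-- The distance form of the corona splits into that of `G`, applied to the fibre sums, and those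
of the copies of `K₁ + H`. -/
lemma distForm_corona {V₁ V₂ : Type*} [Fintype V₁] [Fintype V₂] {G : SimpleGraph V₁}
    (H : SimpleGraph V₂) (hG : G.Connected) (f : V₁ × Option V₂ → ℝ) (hf : ∑ p, f p = 0) :
    distForm (corona G H) f = distForm G (fun i => ∑ x, f (i, x)) +
      ∑ i, distForm (cone H) (recenter fun x => f (i, x)) := by
  set S : V₁ → ℝ := fun i => ∑ x, f (i, x) with hS
  set T : V₁ → ℝ := fun i => ∑ x, ((cone H).dist x none : ℝ) * f (i, x) with hT
  have hS0 : ∑ i, S i = 0 := by rw [← hf, Fintype.sum_prod_type]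
  have hd : ∀ i j x y, ((corona G H).dist (i, x) (j, y) : ℝ) =
      G.dist i j + (cone H).dist x none + (cone H).dist y none +
        if i = j then ((cone H).dist x y - (cone H).dist x none - (cone H).dist y none : ℝ)
        else 0 := fun i j x y => by
    rw [corona_dist H hG, SimpleGraph.dist_comm (u := none) (v := y)]
    split_ifs with h
    · subst h
      simp
    · push_cast
      ring
  have hblock : ∀ i j, ∑ x, ∑ y, f (i, x) * ((corona G H).dist (i, x) (j, y) : ℝ) * f (j, y) =
      S i * G.dist i j * S j + T i * S j + S i * T j +
        if i = j then distForm (cone H) (recenter fun x => f (i, x)) else 0 := fun i j => by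
    have e1 : S i * G.dist i j * S j = ∑ x, ∑ y, f (i, x) * G.dist i j * f (j, y) := by
      simp only [hS, Finset.sum_mul, Finset.mul_sum]
      rw [Finset.sum_comm]
    have e2 : ∀ i j, T i * S j = ∑ x, ∑ y, f (i, x) * (cone H).dist x none * f (j, y) :=
      fun i j => by
        simp only [hS, hT, Finset.sum_mul_sum]
        exact Finset.sum_congr rfl fun x _ => Finset.sum_congr rfl fun y _ => by ring
    have e3 : ∀ i j, S i * T j = ∑ x, ∑ y, f (i, x) * (cone H).dist y none * f (j, y) :=
      fun i j => by
        simp only [hS, hT, Finset.sum_mul_sum]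
        exact Finset.sum_congr rfl fun x _ => Finset.sum_congr rfl fun y _ => by ring
    have e4 : distForm (cone H) (recenter fun x => f (i, x)) =
        distForm (cone H) (fun x => f (i, x)) - T i * S i - S i * T i := by
      rw [distForm_recenter]
      ring
    rw [e4, e1, e2 i j, e3 i j, e2 i i, e3 i i, distForm]
    split_ifs with h
    · subst h
      simp only [← Finset.sum_add_distrib, ← Finset.sum_sub_distrib]
      refine Finset.sum_congr rfl fun x _ => Finset.sum_congr rfl fun y _ => ?_
      rw [hd, if_pos rfl]
      ring
    · simp only [← Finset.sum_add_distrib, add_zero]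
      refine Finset.sum_congr rfl fun x _ => Finset.sum_congr rfl fun y _ => ?_
      rw [hd, if_neg h]
      ring
  calc distForm (corona G H) f
      = ∑ i, ∑ j, ∑ x, ∑ y, f (i, x) * ((corona G H).dist (i, x) (j, y) : ℝ) * f (j, y) := by
        simp only [distForm, Fintype.sum_prod_type]
        exact Finset.sum_congr rfl fun i _ => Finset.sum_comm
    _ = _ := by
        simp only [hblock, Finset.sum_add_distrib, ← Finset.mul_sum, ← Finset.sum_mul, hS0,
          mul_zero, zero_mul, add_zero, Finset.sum_ite_eq,
          Finset.mem_univ, if_true]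
        rfl

lemma QEC_corona_nonpos {V₁ V₂ : Type*} [Fintype V₁] [Fintype V₂] {G : SimpleGraph V₁}
    {H : SimpleGraph V₂} (hG : G.Connected) (h₁ : QEC G ≤ 0) (h₂ : QEC (cone H) ≤ 0) :
    QEC (corona G H) ≤ 0 := by
  refine Real.sSup_nonpos ?_
  rintro r ⟨f, -, hf, rfl⟩
  change distForm (corona G H) f ≤ 0
  rw [distForm_corona H hG f hf]
  refine add_nonpos (distForm_nonpos h₁ ?_)
    (Finset.sum_nonpos fun i _ => distForm_nonpos h₂ (sum_recenter _))
  rw [← hf, Fintype.sum_prod_type]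

lemma QEC_le_QEC_corona {V₁ V₂ : Type*} [Fintype V₁] [Fintype V₂] {G : SimpleGraph V₁}
    (H : SimpleGraph V₂) (hG : G.Connected) (hV₁ : 2 ≤ Fintype.card V₁) :
    QEC G ≤ QEC (corona G H) := by
  have hs : ∀ (f : V₁ → ℝ) i, ∑ x : Option V₂, (if x = none then f i else 0) = f i :=
    fun f i => by simp
  have hsum : ∀ f : V₁ → ℝ, ∑ x, f x = 0 →
      ∑ p : V₁ × Option V₂, (if p.2 = none then f p.1 else 0) = 0 := fun f hf => by
    rw [Fintype.sum_prod_type]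
    simp only [hs, hf]
  refine QEC_le_of_map hV₁ (fun f p => if p.2 = none then f p.1 else 0) (fun f => ?_) hsum
    fun f hf => ?_
  · simp [Fintype.sum_prod_type]
  · rw [distForm_corona H hG _ (hsum f hf)]
    simp only [hs]
    refine add_eq_left.2 (Finset.sum_eq_zero fun i _ => ?_)
    refine Eq.trans (congrArg _ (funext fun x => ?_)) (distForm_zero (cone H))
    cases x <;> simp [recenter]

lemma QEC_cone_le_QEC_corona {V₁ V₂ : Type*} [Fintype V₁] [Fintype V₂] {G : SimpleGraph V₁}
    (H : SimpleGraph V₂) (hG : G.Connected) (hV₂ : 1 ≤ Fintype.card V₂) :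
    QEC (cone H) ≤ QEC (corona G H) := by
  obtain ⟨k⟩ := hG.nonempty
  have hsum : ∀ f : Option V₂ → ℝ, ∑ x, f x = 0 →
      ∑ p : V₁ × Option V₂, (if p.1 = k then f p.2 else 0) = 0 := fun f hf => by
    rw [Fintype.sum_prod_type_right]
    simpa using hf
  refine QEC_le_of_map (by rw [Fintype.card_option]; omega)
    (fun f p => if p.1 = k then f p.2 else 0) (fun f => ?_) hsum fun f hf => ?_
  · simp [Fintype.sum_prod_type_right]
  · rw [distForm_corona H hG _ (hsum f hf)]
    have hfib : (fun i => ∑ x, if i = k then f x else 0) = fun _ : V₁ => (0 : ℝ) := by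
      funext i
      split_ifs
      · exact hf
      · simp
    dsimp only
    rw [hfib, distForm_zero, zero_add, Finset.sum_eq_single k]
    · simp [recenter_eq_self hf]
    · intro i _ hi
      simp only [hi, if_false]
      rw [recenter_eq_self (by simp), distForm_zero]
    · simp

/-- `QEC(G⊙H) = 0` if `QEC(G) = 0, QEC(K₁+H) ≤ 0` or
`QEC(G) ≤ 0, QEC(K₁+H) = 0`. -/
theorem qec_corona_eq_zero {V₁ V₂ : Type*} [Fintype V₁] [Fintype V₂]
    (G : SimpleGraph V₁) (H : SimpleGraph V₂) (hG : G.Connected)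
    (hV₁ : 2 ≤ Fintype.card V₁) (hV₂ : 1 ≤ Fintype.card V₂)
    (h : (QEC G = 0 ∧ QEC (cone H) ≤ 0) ∨ (QEC G ≤ 0 ∧ QEC (cone H) = 0)) :
    QEC (corona G H) = 0 := by
  rcases h with ⟨h₁, h₂⟩ | ⟨h₁, h₂⟩
  · exact le_antisymm (QEC_corona_nonpos hG h₁.le h₂) (h₁ ▸ QEC_le_QEC_corona H hG hV₁)
  · exact le_antisymm (QEC_corona_nonpos hG h₁ h₂.le) (h₂ ▸ QEC_cone_le_QEC_corona H hG hV₂)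

end QECPaper
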